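/- arXiv:2402.04344 — 9 statements merged into one kernel-verified Lean document; each statement's English description precedes it below -/
import Mathlib

section
/- Let K ≥ 2 be an integer, let f_1 > f_2 > ⋯ > f_K be real numbers, and let t ∈ (0,1). Then exp(f_1/t) / (Σ_{i=1}^K exp(f_i/t)) > exp(f_1) / (Σ_{i=1}^K exp(f_i)); that is, applying a temperature t < 1 strictly increases the largest softmax probability. -/
open Finset

/-- Applying a temperature `t < 1` strictly increases the largest softmax probability.
Indices `0, 1, …, K-1` correspond to classes `1, …, K`, so `f 0` is the largest logit. -/
theorem small_temperature_increases_max_softmax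
    (K : ℕ) (hK : 2 ≤ K) (f : ℕ → ℝ)
    (hf : ∀ i j : ℕ, i < j → j < K → f j < f i)
    (t : ℝ) (ht0 : 0 < t) (ht1 : t < 1) :
    Real.exp (f 0 / t) / (∑ i ∈ Finset.range K, Real.exp (f i / t)) >
      Real.exp (f 0) / (∑ i ∈ Finset.range K, Real.exp (f i)) := by
  have hne : (Finset.range K).Nonempty := ⟨0, Finset.mem_range.2 (by omega)⟩
  have h1 : 0 < ∑ i ∈ Finset.range K, Real.exp (f i / t) :=
    Finset.sum_pos (fun i _ => Real.exp_pos _) hne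
  have h2 : 0 < ∑ i ∈ Finset.range K, Real.exp (f i) :=
    Finset.sum_pos (fun i _ => Real.exp_pos _) hne
  have ht : 1 < t⁻¹ := (one_lt_inv₀ ht0).2 ht1
  rw [gt_iff_lt, div_lt_div_iff₀ h2 h1, Finset.mul_sum, Finset.mul_sum]
  have key : ∀ j, 0 < j → j < K →
      Real.exp (f 0) * Real.exp (f j / t) < Real.exp (f 0 / t) * Real.exp (f j) := by
    intro j hj hjK
    rw [← Real.exp_add, ← Real.exp_add, Real.exp_lt_exp, div_eq_mul_inv, div_eq_mul_inv]
    nlinarith [mul_pos (sub_pos.2 (hf 0 j hj hjK)) (sub_pos.2 ht)]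
  refine Finset.sum_lt_sum (fun i hi => ?_)
    ⟨1, Finset.mem_range.2 (by omega), key 1 one_pos (by omega)⟩
  rcases Nat.eq_zero_or_pos i with rfl | h
  · rw [mul_comm]
  · exact (key i h (Finset.mem_range.1 hi)).le
end

section
/- Let K ≥ 2 be an integer, let f_1 > f_2 > ⋯ > f_K be real numbers, and let t ∈ (0,1). Then exp(f_K/t) / (Σ_{i=1}^K exp(f_i/t)) < exp(f_K) / (Σ_{i=1}^K exp(f_i)); that is, applying a temperature t < 1 strictly decreases the smallest softmax probability. -/
open Finset

/-- Applying a temperature `t < 1` strictly decreases the smallest softmax probability.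
Indices `0, 1, …, K-1` correspond to classes `1, …, K`, so `f (K-1)` is the smallest logit. -/
theorem small_temperature_decreases_min_softmax
    (K : ℕ) (hK : 2 ≤ K) (f : ℕ → ℝ)
    (hf : ∀ i j : ℕ, i < j → j < K → f j < f i)
    (t : ℝ) (ht0 : 0 < t) (ht1 : t < 1) :
    Real.exp (f (K - 1) / t) / (∑ i ∈ Finset.range K, Real.exp (f i / t)) <
      Real.exp (f (K - 1)) / (∑ i ∈ Finset.range K, Real.exp (f i)) := by
  have hne : (Finset.range K).Nonempty := ⟨0, Finset.mem_range.2 (by omega)⟩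
  have h1 : 0 < ∑ i ∈ Finset.range K, Real.exp (f i / t) :=
    Finset.sum_pos (fun i _ => Real.exp_pos _) hne
  have h2 : 0 < ∑ i ∈ Finset.range K, Real.exp (f i) :=
    Finset.sum_pos (fun i _ => Real.exp_pos _) hne
  have hs : 1 < t⁻¹ := (one_lt_inv₀ ht0).2 ht1
  rw [div_lt_div_iff₀ h1 h2, Finset.mul_sum, Finset.mul_sum]
  apply Finset.sum_lt_sum
  · intro i hi
    rw [Finset.mem_range] at hi
    have hle : f (K - 1) ≤ f i := by
      rcases Nat.lt_or_ge i (K - 1) with h | h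
      · exact (hf i (K - 1) h (by omega)).le
      · have : i = K - 1 := by omega
        rw [this]
    rw [← Real.exp_add, ← Real.exp_add, Real.exp_le_exp, div_eq_mul_inv, div_eq_mul_inv]
    nlinarith [mul_nonneg (sub_nonneg.2 hle) (sub_pos.2 hs).le]
  · refine ⟨0, Finset.mem_range.2 (by omega), ?_⟩
    have hlt : f (K - 1) < f 0 := hf 0 (K - 1) (by omega) (by omega)
    rw [← Real.exp_add, ← Real.exp_add, Real.exp_lt_exp, div_eq_mul_inv, div_eq_mul_inv]
    nlinarith [mul_pos (sub_pos.2 hlt) (sub_pos.2 hs)]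
end

section
/- Let K ≥ 2 be an integer, let f_1 > f_2 > ⋯ > f_K be real numbers, and let t ∈ (0,1). If there exists an index j with 1 < j ≤ K such that exp(f_j/t) / (Σ_{i=1}^K exp(f_i/t)) > exp(f_j) / (Σ_{i=1}^K exp(f_i)), then for every index k with 1 ≤ k ≤ j one also has exp(f_k/t) / (Σ_{i=1}^K exp(f_i/t)) > exp(f_k) / (Σ_{i=1}^K exp(f_i)). -/
open Finset

/-- If the temperature-scaled softmax probability of some class `j` (zero-indexed, with
`1 ≤ j < K`, i.e. `1 < j+1 ≤ K` one-indexed) strictly exceeds its ordinary softmax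
probability, then the same holds for every class `k ≤ j`. -/
theorem softmax_increase_propagates_upward
    (K : ℕ) (hK : 2 ≤ K) (f : ℕ → ℝ)
    (hf : ∀ i j : ℕ, i < j → j < K → f j < f i)
    (t : ℝ) (ht0 : 0 < t) (ht1 : t < 1)
    (j : ℕ) (hj1 : 1 ≤ j) (hjK : j < K)
    (hj : Real.exp (f j / t) / (∑ i ∈ Finset.range K, Real.exp (f i / t)) >
          Real.exp (f j) / (∑ i ∈ Finset.range K, Real.exp (f i))) :
    ∀ k : ℕ, k ≤ j →
      Real.exp (f k / t) / (∑ i ∈ Finset.range K, Real.exp (f i / t)) >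
        Real.exp (f k) / (∑ i ∈ Finset.range K, Real.exp (f i)) := by
  intro k hk
  have hd : f j ≤ f k := by
    rcases hk.eq_or_lt with h | h
    · rw [h]
    · exact (hf k j h hjK).le
  have hne : (Finset.range K).Nonempty := ⟨j, Finset.mem_range.2 hjK⟩
  have hA : 0 < ∑ i ∈ Finset.range K, Real.exp (f i / t) :=
    Finset.sum_pos (fun i _ => Real.exp_pos _) hne
  have hB : 0 < ∑ i ∈ Finset.range K, Real.exp (f i) :=
    Finset.sum_pos (fun i _ => Real.exp_pos _) hne
  have h1 : Real.exp (f k) = Real.exp (f j) * Real.exp (f k - f j) := by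
    rw [← Real.exp_add]; congr 1; ring
  have h2 : Real.exp (f j / t) * Real.exp (f k - f j) ≤ Real.exp (f k / t) := by
    rw [← Real.exp_add, Real.exp_le_exp]
    have h3 : f k - f j ≤ (f k - f j) / t :=
      le_div_self (sub_nonneg.2 hd) ht0 ht1.le
    rw [sub_div] at h3
    linarith
  calc Real.exp (f k) / (∑ i ∈ Finset.range K, Real.exp (f i))
      = Real.exp (f j) / (∑ i ∈ Finset.range K, Real.exp (f i)) * Real.exp (f k - f j) := by
        rw [h1]; ring
    _ < Real.exp (f j / t) / (∑ i ∈ Finset.range K, Real.exp (f i / t))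
          * Real.exp (f k - f j) := mul_lt_mul_of_pos_right hj (Real.exp_pos _)
    _ = (Real.exp (f j / t) * Real.exp (f k - f j))
          / (∑ i ∈ Finset.range K, Real.exp (f i / t)) := by ring
    _ ≤ _ := div_le_div_of_nonneg_right h2 hA.le
end

section
/- Let K ≥ 2 be an integer, let f_1 > f_2 > ⋯ > f_K be real numbers, and let t ∈ (0,1). Then for every k ∈ {1, …, K}: Σ_{i=1}^k exp(f_i/t) / (Σ_{j=1}^K exp(f_j/t)) ≥ Σ_{i=1}^k exp(f_i) / (Σ_{j=1}^K exp(f_j)), and equality holds if and only if k = K. -/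
open Finset

/-- For every `k ∈ {1, …, K}`, the sum of the `k` largest temperature-scaled (with `t < 1`)
softmax probabilities is at least the corresponding sum at temperature `1`, with equality
if and only if `k = K`. -/
theorem partial_softmax_sum_ge_of_small_temperature
    (K : ℕ) (hK : 2 ≤ K) (f : ℕ → ℝ)
    (hf : ∀ i j : ℕ, i < j → j < K → f j < f i)
    (t : ℝ) (ht0 : 0 < t) (ht1 : t < 1)
    (k : ℕ) (hk1 : 1 ≤ k) (hkK : k ≤ K) :
    (∑ i ∈ Finset.range k, Real.exp (f i / t)) / (∑ j ∈ Finset.range K, Real.exp (f j / t)) ≥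
      (∑ i ∈ Finset.range k, Real.exp (f i)) / (∑ j ∈ Finset.range K, Real.exp (f j)) ∧
    ((∑ i ∈ Finset.range k, Real.exp (f i / t)) / (∑ j ∈ Finset.range K, Real.exp (f j / t)) =
      (∑ i ∈ Finset.range k, Real.exp (f i)) / (∑ j ∈ Finset.range K, Real.exp (f j)) ↔
      k = K) := by
  have hpos : ∀ g : ℕ → ℝ, 0 < ∑ j ∈ Finset.range K, Real.exp (g j) := fun g =>
    Finset.sum_pos (fun _ _ => Real.exp_pos _) ⟨0, Finset.mem_range.2 (by omega)⟩
  have h1 := hpos (fun j => f j / t)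
  have h2 := hpos f
  rcases hkK.eq_or_lt with rfl | hlt
  · rw [div_self h1.ne', div_self h2.ne']
    simp
  · have key : (∑ i ∈ Finset.range k, Real.exp (f i)) * (∑ j ∈ Finset.Ico k K, Real.exp (f j / t))
        < (∑ i ∈ Finset.range k, Real.exp (f i / t)) * (∑ j ∈ Finset.Ico k K, Real.exp (f j)) := by
      rw [Finset.sum_mul_sum, Finset.sum_mul_sum]
      refine Finset.sum_lt_sum_of_nonempty ⟨0, Finset.mem_range.2 (by omega)⟩ fun i hi => ?_
      refine Finset.sum_lt_sum_of_nonempty ⟨k, Finset.mem_Ico.2 ⟨le_rfl, hlt⟩⟩ fun j hj => ?_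
      rw [Finset.mem_range] at hi
      rw [Finset.mem_Ico] at hj
      have hd := hf i j (by omega) hj.2
      rw [← Real.exp_add, ← Real.exp_add, Real.exp_lt_exp]
      have h3 : f i - f j < (f i - f j) / t := by
        rw [lt_div_iff₀ ht0]
        nlinarith
      rw [sub_div] at h3
      linarith
    have hs : (∑ i ∈ Finset.range k, Real.exp (f i)) / (∑ j ∈ Finset.range K, Real.exp (f j)) <
        (∑ i ∈ Finset.range k, Real.exp (f i / t)) /
          (∑ j ∈ Finset.range K, Real.exp (f j / t)) := by
      rw [div_lt_div_iff₀ h2 h1, ← Finset.sum_range_add_sum_Ico _ hkK,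
        ← Finset.sum_range_add_sum_Ico (fun j => Real.exp (f j)) hkK]
      nlinarith
    exact ⟨hs.le, fun h => absurd h hs.ne', fun h => absurd h hlt.ne⟩
end

section
/- Let K ≥ 2 be an integer, let f_1 > f_2 > ⋯ > f_K be real numbers, fix a temperature t_0 > 0, and let t ∈ (0, t_0). Then for every class k ∈ {1, …, K}, the non-randomized APS score satisfies S(f,k,t_0) ≤ S(f,k,t), where S(f,k,u) = Σ_{i=1}^k exp(f_i/u) / (Σ_{j=1}^K exp(f_j/u)). -/
open Finset

/-- The non-randomized APS score of class `k` (one-indexed: the score sums the `k` largest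
softmax probabilities) for logits `f` (zero-indexed, strictly decreasing) at temperature `u`. -/
noncomputable def APSscore (K : ℕ) (f : ℕ → ℝ) (k : ℕ) (u : ℝ) : ℝ :=
  (∑ i ∈ Finset.range k, Real.exp (f i / u)) / (∑ j ∈ Finset.range K, Real.exp (f j / u))

/-- Lowering the temperature from `t₀` to `t ∈ (0, t₀)` can only increase the
non-randomized APS score of every class `k ∈ {1, …, K}`. -/
theorem APSscore_antitone_in_temperature
    (K : ℕ) (hK : 2 ≤ K) (f : ℕ → ℝ)
    (hf : ∀ i j : ℕ, i < j → j < K → f j < f i)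
    (t₀ : ℝ) (ht₀ : 0 < t₀) (t : ℝ) (ht : 0 < t) (htt₀ : t < t₀)
    (k : ℕ) (hk1 : 1 ≤ k) (hkK : k ≤ K) :
    APSscore K f k t₀ ≤ APSscore K f k t := by
  have hpos : ∀ u : ℝ, 0 < ∑ j ∈ Finset.range K, Real.exp (f j / u) := fun u =>
    Finset.sum_pos (fun _ _ => Real.exp_pos _) ⟨0, Finset.mem_range.2 (by omega)⟩
  unfold APSscore
  rw [div_le_div_iff₀ (hpos t₀) (hpos t)]
  rw [← Finset.sum_range_add_sum_Ico (fun j => Real.exp (f j / t)) hkK,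
    ← Finset.sum_range_add_sum_Ico (fun j => Real.exp (f j / t₀)) hkK]
  have key : (∑ i ∈ Finset.range k, Real.exp (f i / t₀)) *
      (∑ j ∈ Finset.Ico k K, Real.exp (f j / t)) ≤
      (∑ i ∈ Finset.range k, Real.exp (f i / t)) *
      (∑ j ∈ Finset.Ico k K, Real.exp (f j / t₀)) := by
    rw [Finset.sum_mul_sum, Finset.sum_mul_sum]
    refine Finset.sum_le_sum fun i hi => Finset.sum_le_sum fun j hj => ?_
    rw [← Real.exp_add, ← Real.exp_add, Real.exp_le_exp]
    rw [Finset.mem_range] at hi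
    rw [Finset.mem_Ico] at hj
    have h1 := hf i j (by omega) hj.2
    have h2 : t₀⁻¹ ≤ t⁻¹ := inv_anti₀ ht htt₀.le
    simp only [div_eq_mul_inv]
    nlinarith [mul_nonneg (sub_nonneg.2 h1.le) (sub_nonneg.2 h2)]
  linarith [key, mul_comm (∑ i ∈ Finset.range k, Real.exp (f i / t₀))
    (∑ i ∈ Finset.range k, Real.exp (f i / t))]
end

section
/- Let K ≥ 2 be an integer, let f_1 > f_2 > ⋯ > f_K be real numbers, fix a temperature t_0 > 0, and let t ∈ (0, t_0). Then for every class k with 1 ≤ k < K, the non-randomized APS score satisfies the strict inequality S(f,k,t_0) < S(f,k,t). -/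
open Finset

/-- Lowering the temperature from `t₀` to `t ∈ (0, t₀)` strictly increases the
non-randomized APS score of every class `k` with `1 ≤ k < K`. -/
theorem APSscore_strict_anti_in_temperature
    (K : ℕ) (hK : 2 ≤ K) (f : ℕ → ℝ)
    (hf : ∀ i j : ℕ, i < j → j < K → f j < f i)
    (t₀ : ℝ) (ht₀ : 0 < t₀) (t : ℝ) (ht : 0 < t) (htt₀ : t < t₀)
    (k : ℕ) (hk1 : 1 ≤ k) (hkK : k < K) :
    APSscore K f k t₀ < APSscore K f k t := by
  have hpos : ∀ (u : ℝ) (s : Finset ℕ), s.Nonempty → 0 < ∑ j ∈ s, Real.exp (f j / u) :=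
    fun u s hs => Finset.sum_pos (fun _ _ => Real.exp_pos _) hs
  have hkr : (Finset.range k).Nonempty := ⟨0, Finset.mem_range.2 (by omega)⟩
  have hKr : (Finset.range K).Nonempty := ⟨0, Finset.mem_range.2 (by omega)⟩
  have hkK' : (Finset.Ico k K).Nonempty := ⟨k, Finset.mem_Ico.2 ⟨le_refl k, hkK⟩⟩
  have key : (∑ i ∈ Finset.range k, Real.exp (f i / t₀)) * (∑ j ∈ Finset.Ico k K, Real.exp (f j / t))
      < (∑ i ∈ Finset.range k, Real.exp (f i / t)) * (∑ j ∈ Finset.Ico k K, Real.exp (f j / t₀)) := by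
    rw [Finset.sum_mul_sum, Finset.sum_mul_sum]
    refine Finset.sum_lt_sum_of_nonempty hkr fun i hi => ?_
    refine Finset.sum_lt_sum_of_nonempty hkK' fun j hj => ?_
    rw [Finset.mem_range] at hi
    rw [Finset.mem_Ico] at hj
    rw [← Real.exp_add, ← Real.exp_add, Real.exp_lt_exp]
    have h1 : f j < f i := hf i j (by omega) hj.2
    have h2 : 1 / t₀ < 1 / t := one_div_lt_one_div_of_lt ht htt₀
    have h3 := mul_pos (sub_pos.2 h1) (sub_pos.2 h2)
    simp only [div_eq_mul_one_div (f _)]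
    nlinarith [h3]
  unfold APSscore
  rw [div_lt_div_iff₀ (hpos _ _ hKr) (hpos _ _ hKr),
    ← Finset.sum_range_add_sum_Ico (fun j => Real.exp (f j / t)) hkK.le,
    ← Finset.sum_range_add_sum_Ico (fun j => Real.exp (f j / t₀)) hkK.le]
  linarith [key, mul_comm (∑ i ∈ Finset.range k, Real.exp (f i / t₀)) (∑ i ∈ Finset.range k, Real.exp (f i / t))]
end

section
/- Let K ≥ 2 be an integer, let f_1 > f_2 > ⋯ > f_K be real numbers, fix a temperature t_0 > 0 and a class k ∈ {1, …, K}, and define ε(k,t) = S(f,k,t) − S(f,k,t_0) for t ∈ (0, t_0). Then t ↦ ε(k,t) is decreasing on (0, t_0): for all 0 < t_1 < t_2 < t_0 one has ε(k,t_1) ≥ ε(k,t_2), and the inequality is strict whenever k < K. -/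
open Finset

/-- The score deviation `ε(k,t) = S(f,k,t) − S(f,k,t₀)` at temperature `t ∈ (0, t₀)`
relative to a fixed reference temperature `t₀`. -/
noncomputable def scoreDeviation (K : ℕ) (f : ℕ → ℝ) (k : ℕ) (t₀ t : ℝ) : ℝ :=
  APSscore K f k t - APSscore K f k t₀

/-- For a fixed class `k ∈ {1, …, K}`, the score deviation `t ↦ ε(k,t)` is decreasing on
`(0, t₀)`: for `0 < t₁ < t₂ < t₀` we have `ε(k,t₁) ≥ ε(k,t₂)`, strictly whenever `k < K`. -/
theorem scoreDeviation_decreasing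
    (K : ℕ) (hK : 2 ≤ K) (f : ℕ → ℝ)
    (hf : ∀ i j : ℕ, i < j → j < K → f j < f i)
    (t₀ : ℝ) (ht₀ : 0 < t₀)
    (k : ℕ) (hk1 : 1 ≤ k) (hkK : k ≤ K)
    (t₁ t₂ : ℝ) (ht₁ : 0 < t₁) (h₁₂ : t₁ < t₂) (h₂₀ : t₂ < t₀) :
    scoreDeviation K f k t₀ t₂ ≤ scoreDeviation K f k t₀ t₁ ∧
      (k < K → scoreDeviation K f k t₀ t₂ < scoreDeviation K f k t₀ t₁) := by
  have strict : k < K → scoreDeviation K f k t₀ t₂ < scoreDeviation K f k t₀ t₁ := by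
    intro hlt
    have ht₂ : 0 < t₂ := ht₁.trans h₁₂
    have hne1 : (Finset.range k).Nonempty := Finset.nonempty_range_iff.mpr (by omega)
    have hne2 : (Finset.Ico k K).Nonempty := Finset.nonempty_Ico.mpr hlt
    have key : (∑ i ∈ Finset.range k, Real.exp (f i / t₂)) *
          (∑ j ∈ Finset.Ico k K, Real.exp (f j / t₁)) <
        (∑ i ∈ Finset.range k, Real.exp (f i / t₁)) *
          (∑ j ∈ Finset.Ico k K, Real.exp (f j / t₂)) := by
      rw [Finset.sum_mul_sum, Finset.sum_mul_sum]
      refine Finset.sum_lt_sum_of_nonempty hne1 fun i hi => ?_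
      refine Finset.sum_lt_sum_of_nonempty hne2 fun j hj => ?_
      rw [← Real.exp_add, ← Real.exp_add, Real.exp_lt_exp]
      rw [Finset.mem_range] at hi
      rw [Finset.mem_Ico] at hj
      have h1 := hf i j (by omega) hj.2
      have h2 : t₂⁻¹ < t₁⁻¹ := inv_strictAnti₀ ht₁ h₁₂
      simp only [div_eq_mul_inv]
      nlinarith [mul_pos (sub_pos.mpr h1) (sub_pos.mpr h2)]
    have pA : ∀ t : ℝ, 0 < ∑ i ∈ Finset.range k, Real.exp (f i / t) := fun t =>
      Finset.sum_pos (fun i _ => Real.exp_pos _) hne1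
    have pB : ∀ t : ℝ, 0 < ∑ i ∈ Finset.Ico k K, Real.exp (f i / t) := fun t =>
      Finset.sum_pos (fun i _ => Real.exp_pos _) hne2
    unfold scoreDeviation APSscore
    simp only [← Finset.sum_range_add_sum_Ico _ hkK]
    apply sub_lt_sub_right
    rw [div_lt_div_iff₀ (add_pos (pA _) (pB _)) (add_pos (pA _) (pB _))]
    linarith
  refine ⟨?_, strict⟩
  rcases hkK.lt_or_eq with h | h
  · exact (strict h).le
  · subst h
    have hne1 : (Finset.range k).Nonempty := Finset.nonempty_range_iff.mpr (by omega)
    have one : ∀ t : ℝ, APSscore k f k t = 1 := fun t =>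
      div_self (Finset.sum_pos (fun i _ => Real.exp_pos _) hne1).ne'
    simp [scoreDeviation, one]
end

section
/- Let K ≥ 2 be an integer, let f_1 > f_2 > ⋯ > f_K be real numbers, and let 0 < t_1 < t_2. Then the largest softmax probability is strictly larger at the lower temperature: exp(f_1/t_1) / (Σ_{i=1}^K exp(f_i/t_1)) > exp(f_1/t_2) / (Σ_{i=1}^K exp(f_i/t_2)). -/
open Finset

/-- The largest softmax probability is strictly larger at the lower temperature:
for `0 < t₁ < t₂`, class `1` (index `0`) has a strictly larger temperature-scaled
softmax probability at `t₁` than at `t₂`. -/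
theorem max_softmax_strict_anti_in_temperature
    (K : ℕ) (hK : 2 ≤ K) (f : ℕ → ℝ)
    (hf : ∀ i j : ℕ, i < j → j < K → f j < f i)
    (t₁ t₂ : ℝ) (ht₁ : 0 < t₁) (ht₁₂ : t₁ < t₂) :
    Real.exp (f 0 / t₁) / (∑ i ∈ Finset.range K, Real.exp (f i / t₁)) >
      Real.exp (f 0 / t₂) / (∑ i ∈ Finset.range K, Real.exp (f i / t₂)) := by
  have ht₂ : 0 < t₂ := ht₁.trans ht₁₂
  have hinv : t₂⁻¹ < t₁⁻¹ := (inv_lt_inv₀ ht₂ ht₁).2 ht₁₂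
  have hne : (Finset.range K).Nonempty := ⟨0, Finset.mem_range.2 (by omega)⟩
  have h1 : 0 < ∑ i ∈ Finset.range K, Real.exp (f i / t₁) :=
    Finset.sum_pos (fun i _ => Real.exp_pos _) hne
  have h2 : 0 < ∑ i ∈ Finset.range K, Real.exp (f i / t₂) :=
    Finset.sum_pos (fun i _ => Real.exp_pos _) hne
  rw [gt_iff_lt, div_lt_div_iff₀ h2 h1, Finset.mul_sum, Finset.mul_sum]
  apply Finset.sum_lt_sum
  · intro i hi
    rw [← Real.exp_add, ← Real.exp_add, Real.exp_le_exp]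
    have hle : f i ≤ f 0 := by
      rcases Nat.eq_zero_or_pos i with h | h
      · rw [h]
      · exact (hf 0 i h (Finset.mem_range.1 hi)).le
    simp only [div_eq_mul_inv]
    nlinarith [mul_nonneg (sub_nonneg.2 hle) (sub_nonneg.2 hinv.le)]
  · refine ⟨1, Finset.mem_range.2 (by omega), ?_⟩
    rw [← Real.exp_add, ← Real.exp_add, Real.exp_lt_exp]
    have hlt : f 1 < f 0 := hf 0 1 (by omega) (by omega)
    simp only [div_eq_mul_inv]
    nlinarith [mul_pos (sub_pos.2 hlt) (sub_pos.2 hinv)]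
end

section
/- Let K ≥ 2 be an integer, let f_1 > f_2 > ⋯ > f_K be real numbers, and let 0 < t_1 < t_2. Then the smallest softmax probability is strictly smaller at the lower temperature: exp(f_K/t_1) / (Σ_{i=1}^K exp(f_i/t_1)) < exp(f_K/t_2) / (Σ_{i=1}^K exp(f_i/t_2)). -/
open Finset

/-- The smallest softmax probability is strictly smaller at the lower temperature:
for `0 < t₁ < t₂`, class `K` (index `K-1`) has a strictly smaller temperature-scaled
softmax probability at `t₁` than at `t₂`. -/
theorem min_softmax_strict_mono_in_temperature
    (K : ℕ) (hK : 2 ≤ K) (f : ℕ → ℝ)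
    (hf : ∀ i j : ℕ, i < j → j < K → f j < f i)
    (t₁ t₂ : ℝ) (ht₁ : 0 < t₁) (ht₁₂ : t₁ < t₂) :
    Real.exp (f (K - 1) / t₁) / (∑ i ∈ Finset.range K, Real.exp (f i / t₁)) <
      Real.exp (f (K - 1) / t₂) / (∑ i ∈ Finset.range K, Real.exp (f i / t₂)) := by
  have hne : (Finset.range K).Nonempty := ⟨0, Finset.mem_range.2 (by omega)⟩
  have hpos : ∀ t : ℝ, 0 < ∑ i ∈ Finset.range K, Real.exp (f i / t) := fun t =>
    Finset.sum_pos (fun i _ => Real.exp_pos _) hne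
  have hinv : t₂⁻¹ < t₁⁻¹ := inv_strictAnti₀ ht₁ ht₁₂
  rw [div_lt_div_iff₀ (hpos t₁) (hpos t₂), Finset.mul_sum, Finset.mul_sum]
  apply Finset.sum_lt_sum
  · intro i hi
    rw [← Real.exp_add, ← Real.exp_add, Real.exp_le_exp]
    have hle : f (K - 1) ≤ f i := by
      have hi' := Finset.mem_range.1 hi
      rcases Nat.lt_or_ge i (K - 1) with h | h
      · exact (hf i (K - 1) h (by omega)).le
      · have : i = K - 1 := by omega
        rw [this]
    simp only [div_eq_mul_inv]
    nlinarith [mul_nonneg (sub_nonneg.2 hle) (sub_nonneg.2 hinv.le)]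
  · refine ⟨0, Finset.mem_range.2 (by omega), ?_⟩
    rw [← Real.exp_add, ← Real.exp_add, Real.exp_lt_exp]
    have hlt : f (K - 1) < f 0 := hf 0 (K - 1) (by omega) (by omega)
    simp only [div_eq_mul_inv]
    nlinarith [mul_pos (sub_pos.2 hlt) (sub_pos.2 hinv)]
end
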